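/- Let R be a complex Hilbert algebra which is commutative. Then every minimal left ideal of R is one-dimensional (as a complex vector space), where a left ideal I of R is called minimal if I ≠ {0} and the only left ideals of R contained in I are {0} and I. -/

import Mathlib

open scoped ComplexInnerProductSpace

noncomputable section

/-- A complex Hilbert algebra (`H*`-algebra): a complex Hilbert space `R` equipped with an
associative `ℂ`-bilinear multiplication and a conjugate-linear involution `x ↦ x*` such that
`‖xy‖ ≤ ‖x‖·‖y‖`, `(x*)* = x`, `(xy)* = y*x*`, `⟪xy, z⟫ = ⟪y, x*z⟫`, `‖x*‖ = ‖x‖`, and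
`xx* ≠ 0` whenever `x ≠ 0`. -/
structure HilbertAlgebra (R : Type*) [NormedAddCommGroup R] [InnerProductSpace ℂ R]
    [CompleteSpace R] where
  mul : R → R → R
  star : R → R
  mul_assoc : ∀ x y z : R, mul (mul x y) z = mul x (mul y z)
  add_mul : ∀ x y z : R, mul (x + y) z = mul x z + mul y z
  mul_add : ∀ x y z : R, mul x (y + z) = mul x y + mul x z
  smul_mul : ∀ (c : ℂ) (x y : R), mul (c • x) y = c • mul x y
  mul_smul : ∀ (c : ℂ) (x y : R), mul x (c • y) = c • mul x y
  norm_mul_le : ∀ x y : R, ‖mul x y‖ ≤ ‖x‖ * ‖y‖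
  star_add : ∀ x y : R, star (x + y) = star x + star y
  star_smul : ∀ (c : ℂ) (x : R), star (c • x) = (starRingEnd ℂ) c • star x
  star_star : ∀ x : R, star (star x) = x
  star_mul : ∀ x y : R, star (mul x y) = mul (star y) (star x)
  inner_mul_left : ∀ x y z : R, ⟪mul x y, z⟫ = ⟪y, mul (star x) z⟫
  norm_star : ∀ x : R, ‖star x‖ = ‖x‖
  mul_star_ne_zero : ∀ x : R, x ≠ 0 → mul x (star x) ≠ 0

/-- A left ideal of a Hilbert algebra: a (complex) linear subspace closed under left
multiplication by arbitrary elements of `R`. -/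
def HilbertAlgebra.IsLeftIdeal {R : Type*} [NormedAddCommGroup R] [InnerProductSpace ℂ R]
    [CompleteSpace R] (A : HilbertAlgebra R) (I : Submodule ℂ R) : Prop :=
  ∀ x : R, ∀ y ∈ I, A.mul x y ∈ I

/-- A minimal left ideal: a left ideal `I ≠ {0}` such that the only left ideals of `R`
contained in `I` are `{0}` and `I`. -/
def HilbertAlgebra.IsMinimalLeftIdeal {R : Type*} [NormedAddCommGroup R]
    [InnerProductSpace ℂ R] [CompleteSpace R] (A : HilbertAlgebra R)
    (I : Submodule ℂ R) : Prop :=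
  A.IsLeftIdeal I ∧ I ≠ ⊥ ∧
    ∀ J : Submodule ℂ R, A.IsLeftIdeal J → J ≤ I → J = ⊥ ∨ J = I

namespace HilbertAlgebra

variable {R : Type*} [NormedAddCommGroup R] [InnerProductSpace ℂ R] [CompleteSpace R]
  (A : HilbertAlgebra R)

lemma zero_mul (x : R) : A.mul 0 x = 0 := by
  simpa using A.smul_mul 0 0 x

/-- Left multiplication by `x`, as a continuous linear endomorphism of a left ideal. -/
def mulLeftOn {I : Submodule ℂ R} (hI : A.IsLeftIdeal I) (x : R) : I →L[ℂ] I :=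
  LinearMap.mkContinuous
    { toFun := fun y => ⟨A.mul x y, hI x y y.2⟩
      map_add' := fun y z => Subtype.ext (A.mul_add x y z)
      map_smul' := fun c y => Subtype.ext (A.mul_smul c x y) }
    ‖x‖ fun y => A.norm_mul_le x y

@[simp]
lemma coe_mulLeftOn_apply {I : Submodule ℂ R} (hI : A.IsLeftIdeal I) (x : R) (y : I) :
    (A.mulLeftOn hI x y : R) = A.mul x y := rfl

variable {A}

/-- In a commutative Hilbert algebra, multiplication by a nonzero element of a minimal left ideal
maps the ideal onto itself. -/
lemma IsMinimalLeftIdeal.exists_mul_eq (hcomm : ∀ x y : R, A.mul x y = A.mul y x)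
    {I : Submodule ℂ R} (hI : A.IsMinimalLeftIdeal I) {b : R} (hb : b ∈ I) (hb0 : b ≠ 0)
    {c : R} (hc : c ∈ I) : ∃ d ∈ I, A.mul d b = c := by
  let J : Submodule ℂ R :=
    { carrier := {z | ∃ d ∈ I, A.mul d b = z}
      add_mem' := by
        rintro _ _ ⟨d, hd, rfl⟩ ⟨e, he, rfl⟩
        exact ⟨d + e, I.add_mem hd he, A.add_mul d e b⟩
      zero_mem' := ⟨0, I.zero_mem, A.zero_mul b⟩
      smul_mem' := by
        rintro r _ ⟨d, hd, rfl⟩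
        exact ⟨r • d, I.smul_mem r hd, A.smul_mul r d b⟩ }
  have hJ : A.IsLeftIdeal J := by
    rintro x _ ⟨d, hd, rfl⟩
    exact ⟨A.mul x d, hI.1 x d hd, A.mul_assoc x d b⟩
  have hJI : J ≤ I := by
    rintro _ ⟨d, -, rfl⟩
    exact hI.1 d b hb
  have hmem : A.mul (A.mul (A.star b) b) b ∈ J := ⟨_, hI.1 _ b hb, rfl⟩
  have hne : A.mul (A.mul (A.star b) b) b ≠ 0 := by
    intro h
    have hsq := A.mul_star_ne_zero _ (A.mul_star_ne_zero b hb0)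
    rw [A.star_mul, A.star_star, ← A.mul_assoc, hcomm b (A.star b), h, A.zero_mul] at hsq
    exact hsq rfl
  have hJeq : J = I := (hI.2.2 J hJ hJI).resolve_left fun h => by
    rw [h] at hmem
    exact hne hmem
  exact hJeq.ge hc

/-- In a commutative Hilbert algebra, every minimal left ideal has an identity element. -/
lemma IsMinimalLeftIdeal.exists_identity (hcomm : ∀ x y : R, A.mul x y = A.mul y x)
    {I : Submodule ℂ R} (hI : A.IsMinimalLeftIdeal I) :
    ∃ e ∈ I, e ≠ 0 ∧ ∀ x ∈ I, A.mul e x = x := by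
  obtain ⟨b, hb, hb0⟩ := I.exists_mem_ne_zero_of_ne_bot hI.2.1
  obtain ⟨e, he, heb⟩ := hI.exists_mul_eq hcomm hb hb0 hb
  refine ⟨e, he, ?_, fun x hx => ?_⟩
  · rintro rfl
    exact hb0 (by rw [← heb, A.zero_mul])
  · obtain ⟨d, -, rfl⟩ := hI.exists_mul_eq hcomm hb hb0 hx
    rw [← A.mul_assoc, hcomm e d, A.mul_assoc, heb]

/-- A left ideal with an identity element in a commutative Hilbert algebra is closed. -/
lemma IsLeftIdeal.isClosed_of_identity (hcomm : ∀ x y : R, A.mul x y = A.mul y x)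
    {I : Submodule ℂ R} (hI : A.IsLeftIdeal I) {e : R} (he : e ∈ I)
    (hone : ∀ x ∈ I, A.mul e x = x) : IsClosed (I : Set R) := by
  have htop : A.IsLeftIdeal ⊤ := fun _ _ _ => trivial
  have hcont : Continuous fun x : R => A.mul e x :=
    continuous_subtype_val.comp
      ((A.mulLeftOn htop e).continuous.comp (continuous_id.subtype_mk fun _ => trivial))
  have hset : (I : Set R) = {x | A.mul e x = x} :=
    Set.ext fun x => ⟨hone x, fun hx => by
      rw [SetLike.mem_coe, ← Set.mem_ofPred_eq.mp hx, hcomm]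
      exact hI x e he⟩
  rw [hset]
  exact isClosed_eq hcont continuous_id

/-- An element of a minimal left ideal acts on the ideal invertibly, unless it vanishes. -/
lemma IsMinimalLeftIdeal.isUnit_mulLeftOn (hcomm : ∀ x y : R, A.mul x y = A.mul y x)
    {I : Submodule ℂ R} (hI : A.IsMinimalLeftIdeal I) {b : R} (hb : b ∈ I) (hb0 : b ≠ 0) :
    IsUnit (A.mulLeftOn hI.1 b) := by
  obtain ⟨e, he, -, hone⟩ := hI.exists_identity hcomm
  obtain ⟨d, -, hdb⟩ := hI.exists_mul_eq hcomm hb hb0 he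
  refine isUnit_iff_exists.mpr ⟨A.mulLeftOn hI.1 d, ?_, ?_⟩ <;> ext y
  · simp [← A.mul_assoc, hcomm b d, hdb, hone y y.2]
  · simp [← A.mul_assoc, hdb, hone y y.2]

end HilbertAlgebra

/-- In a commutative complex Hilbert algebra, every minimal left ideal is one-dimensional. -/
theorem minimal_left_ideal_of_commutative_hilbertAlgebra_one_dimensional
    {R : Type*} [NormedAddCommGroup R] [InnerProductSpace ℂ R] [CompleteSpace R]
    (A : HilbertAlgebra R) (hcomm : ∀ x y : R, A.mul x y = A.mul y x)
    (I : Submodule ℂ R) (hI : A.IsMinimalLeftIdeal I) :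
    Module.rank ℂ I = 1 := by
  obtain ⟨e, he, he0, hone⟩ := hI.exists_identity hcomm
  have : CompleteSpace I := (hI.1.isClosed_of_identity hcomm he hone).completeSpace_coe
  have : Nontrivial I := Submodule.nontrivial_iff_ne_bot.mpr hI.2.1
  refine rank_eq_one (⟨e, he⟩ : I) (fun h => he0 (congrArg Subtype.val h)) fun x => ?_
  obtain ⟨c, hc⟩ := spectrum.nonempty (A.mulLeftOn hI.1 (x : R))
  refine ⟨c, Subtype.ext ?_⟩
  by_contra hne
  have hu := hI.isUnit_mulLeftOn hcomm (I.sub_mem (I.smul_mem c he) x.2) (sub_ne_zero.mpr hne)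
  refine spectrum.mem_iff.mp hc ?_
  convert hu using 1
  ext y
  have hmul : A.mul (c • e - x) y + A.mul x y = c • (y : R) := by
    rw [← A.add_mul, sub_add_cancel, A.smul_mul, hone y y.2]
  simp [Algebra.algebraMap_eq_smul_one, ← hmul]

end
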